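/- (Corollary 2.4: L^θ bounds for K̃_r.) Let 1 ≤ θ ≤ ∞ and let θ' be its Hölder conjugate. There exists a constant C > 0 (depending on d and θ) such that for every r > 0 and every h ∈ ℝ^d: ‖K̃_r‖_{L^θ(ℝ^{1+2d})} ≤ C r^{1−Q/θ'}, ‖∇_y K̃_r‖_{L^θ(ℝ^{1+2d})} ≤ C r^{−2−Q/θ'}, and ‖Δ_x^h K̃_r‖_{L^θ(ℝ^{1+2d})} ≤ C r^{1−Q/θ'} min{1, |h| r^{−3}}. -/

import Mathlib

open MeasureTheory Real ENNReal
open scoped RealInnerProductSpace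

noncomputable section

/-- Euclidean space `ℝ^d`. -/
abbrev V (d : ℕ) : Type := EuclideanSpace ℝ (Fin d)

/-- The kinetic phase space `ℝ^{1+2d}`, with points `(t, x, v)`. -/
abbrev Pt (d : ℕ) : Type := ℝ × V d × V d

/-- Kinetic composition `(t,x,v) ∘ (s,y,w) = (t+s, x+y+s v, v+w)`. -/
def kmul {d : ℕ} (a b : Pt d) : Pt d :=
  (a.1 + b.1, a.2.1 + b.2.1 + b.1 • a.2.2, a.2.2 + b.2.2)

/-- Kinetic inverse `(t,x,v)⁻¹ = (−t, −x+t v, −v)`. -/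
def kinv {d : ℕ} (a : Pt d) : Pt d :=
  (-a.1, -a.2.1 + a.1 • a.2.2, -a.2.2)

/-- `g₁(r) = r³ sin(log r)`, extended by `0` at `r = 0`. -/
def g1 (r : ℝ) : ℝ := r ^ 3 * Real.sin (Real.log r)

/-- `g₂(r) = r³ cos(log r)`, extended by `0` at `r = 0`. -/
def g2 (r : ℝ) : ℝ := r ^ 3 * Real.cos (Real.log r)

/-- `ġ₁(r)/(2r) = (r/2)(3 sin(log r) + cos(log r))`, extended by `0` at `r = 0`. -/
def h1 (r : ℝ) : ℝ := r / 2 * (3 * Real.sin (Real.log r) + Real.cos (Real.log r))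

/-- `ġ₂(r)/(2r) = (r/2)(3 cos(log r) − sin(log r))`, extended by `0` at `r = 0`. -/
def h2 (r : ℝ) : ℝ := r / 2 * (3 * Real.cos (Real.log r) - Real.sin (Real.log r))

/-- The matrix `W(r)`, recorded through its scalar block entries as a `2×2` real matrix;
the full `2d×2d` matrix is the blockwise tensor with `Id_d`. -/
def Wm (r : ℝ) : Matrix (Fin 2) (Fin 2) ℝ := !![g1 r, g2 r; h1 r, h2 r]

/-- The matrix `D_δ` (scalar block entries). -/
def Dm (δ : ℝ) : Matrix (Fin 2) (Fin 2) ℝ := !![δ, 0; 0, 1]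

/-- The matrix `E_δ(r)` (scalar block entries). -/
def Em (δ r : ℝ) : Matrix (Fin 2) (Fin 2) ℝ := !![1, δ * r ^ 2; 0, 1]

/-- `A_{m₀}(r) = D_{m₀} W(r) D_{m₀}⁻¹` (scalar block entries). -/
def Am (m0 r : ℝ) : Matrix (Fin 2) (Fin 2) ℝ := Dm m0 * Wm r * (Dm m0)⁻¹

/-- The action on `ℝ^d × ℝ^d` of a `2×2` block matrix whose blocks are the scalar
multiples of `Id_d` given by the entries of `M`. -/
def act {d : ℕ} (M : Matrix (Fin 2) (Fin 2) ℝ) (p : V d × V d) : V d × V d :=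
  (M 0 0 • p.1 + M 0 1 • p.2, M 1 0 • p.1 + M 1 1 • p.2)

/-- The kinetic trajectory `γ^m(r; (t,x,v))`. -/
def gammaK {d : ℕ} (m : Pt d) (z : Pt d) (r : ℝ) : Pt d :=
  (z.1 + m.1 * r ^ 2,
   (act (Em m.1 r) (z.2.1, z.2.2) + act (Am m.1 r) (m.2.1, m.2.2)).1,
   (act (Em m.1 r) (z.2.1, z.2.2) + act (Am m.1 r) (m.2.1, m.2.2)).2)

/-- Build a vector of `ℝ^d` from components. -/
def mkV {d : ℕ} (f : Fin d → ℝ) : V d := (EuclideanSpace.equiv (Fin d) ℝ).symm f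

/-- The argument `(s/r², A_{s/r²}(r)⁻¹ (y,w)ᵀ)` fed into `ψ`. -/
def psiArg {d : ℕ} (r : ℝ) (m : Pt d) : Pt d :=
  (m.1 / r ^ 2,
   (act ((Am (m.1 / r ^ 2) r)⁻¹) (m.2.1, m.2.2)).1,
   (act ((Am (m.1 / r ^ 2) r)⁻¹) (m.2.1, m.2.2)).2)

/-- The mollification kernel `K_r(s,y,w) = 2^d r^{−Q} ψ(s/r², A_{s/r²}(r)⁻¹(y,w)ᵀ)`,
with `Q = 4d+2`. -/
def Kker {d : ℕ} (ψ : Pt d → ℝ) (r : ℝ) (m : Pt d) : ℝ :=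
  2 ^ d * r ^ (-(4 * (d : ℤ) + 2)) * ψ (psiArg r m)

/-- The kernel `K̃_r(s,y,w) = −2^{d+1} s r^{−Q−1} ψ(s/r², A_{s/r²}(r)⁻¹(y,w)ᵀ)`. -/
def Ktil {d : ℕ} (ψ : Pt d → ℝ) (r : ℝ) (m : Pt d) : ℝ :=
  -(2 ^ (d + 1)) * m.1 * r ^ (-(4 * (d : ℤ) + 2) - 1) * ψ (psiArg r m)

/-- First coefficient of the forcing matrix `F_{m₀}(r)`: `(1/m₀) ∂_r (ġ₁(r)/(2r))`. -/
def F1 (m0 r : ℝ) : ℝ := (1 / m0) * deriv h1 r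

/-- Second coefficient of the forcing matrix `F_{m₀}(r)`: `∂_r (ġ₂(r)/(2r))`. -/
def F2 (r : ℝ) : ℝ := deriv h2 r

/-- The kernel `K⃗_r(s,y,w) = −2^d r^{−Q} ψ(⋯) F_{s/r²}(r) A_{s/r²}(r)⁻¹ (y,w)ᵀ ∈ ℝ^d`. -/
def Kvec {d : ℕ} (ψ : Pt d → ℝ) (r : ℝ) (m : Pt d) : V d :=
  (-(2 ^ d) * r ^ (-(4 * (d : ℤ) + 2)) * ψ (psiArg r m)) •
    (F1 (m.1 / r ^ 2) r • (act ((Am (m.1 / r ^ 2) r)⁻¹) (m.2.1, m.2.2)).1 +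
      F2 r • (act ((Am (m.1 / r ^ 2) r)⁻¹) (m.2.1, m.2.2)).2)

/-- The gradient of `u : ℝ^{1+2d} → ℝ` in the `x`-variables (the `m₁` block). -/
def gradX {d : ℕ} (u : Pt d → ℝ) (z : Pt d) : V d :=
  mkV fun i => fderiv ℝ u z (0, EuclideanSpace.single i 1, 0)

/-- The gradient of `u : ℝ^{1+2d} → ℝ` in the `v`-variables (the `m₂` block). -/
def gradV {d : ℕ} (u : Pt d → ℝ) (z : Pt d) : V d :=
  mkV fun i => fderiv ℝ u z (0, 0, EuclideanSpace.single i 1)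

/-- The kernel `K⃗^π_r(s,y,w)
  = 2^{d+1} s r^{−Q−1} [(A_{s/r²}(r)⁻¹)_{·;2}]ᵀ [∇_{(m₁,m₂)}ψ](⋯) ∈ ℝ^d`. -/
def Kpi {d : ℕ} (ψ : Pt d → ℝ) (r : ℝ) (m : Pt d) : V d :=
  (2 ^ (d + 1) * m.1 * r ^ (-(4 * (d : ℤ) + 2) - 1)) •
    ((Am (m.1 / r ^ 2) r)⁻¹ 0 1 • gradX ψ (psiArg r m) +
      (Am (m.1 / r ^ 2) r)⁻¹ 1 1 • gradV ψ (psiArg r m))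

/-- Kinetic convolution operator for scalar kernels:
`[T_J f](z) = ∫ J(z⁻¹ ∘ m) f(m) dm`. -/
def Tsc {d : ℕ} (J : Pt d → ℝ) (f : Pt d → ℝ) (z : Pt d) : ℝ :=
  ∫ m, J (kmul (kinv z) m) * f m

/-- Kinetic convolution operator for `ℝ^d`-valued kernels:
`[T_J f](z) = ∫ J(z⁻¹ ∘ m) · f(m) dm`. -/
def Tvec {d : ℕ} (J : Pt d → V d) (f : Pt d → V d) (z : Pt d) : ℝ :=
  ∫ m, ⟪J (kmul (kinv z) m), f m⟫

/-- The support and nonnegativity conditions on the bump function `ψ`: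
smooth, nonnegative, unit mass, supported in `(−2,−1) × B₁(0) × B₁(0)`. -/
structure IsKineticBump {d : ℕ} (ψ : Pt d → ℝ) : Prop where
  smooth : ContDiff ℝ (⊤ : ℕ∞) ψ
  nonneg : ∀ m, 0 ≤ ψ m
  mass : ∫ m, ψ m = 1
  supp : ∀ m : Pt d, ψ m ≠ 0 →
    m.1 ∈ Set.Ioo (-2 : ℝ) (-1) ∧ ‖m.2.1‖ < 1 ∧ ‖m.2.2‖ < 1

/-- The kinetic box `B_r^kin = {(s,y,w) : |s| < r², |y| < r³, |w| < r}`. -/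
def kinBox (d : ℕ) (r : ℝ) : Set (Pt d) :=
  {m | |m.1| < r ^ 2 ∧ ‖m.2.1‖ < r ^ 3 ∧ ‖m.2.2‖ < r}

/-- The gradient of a scalar kernel `J(s,y,w)` in the spatial kernel variable `y`. -/
def gradYker {d : ℕ} (J : Pt d → ℝ) (m : Pt d) : V d :=
  mkV fun i => fderiv ℝ (fun y : V d => J (m.1, y, m.2.2)) m.2.1 (EuclideanSpace.single i 1)

/-- A function bounded by `K * r ^ (a - q)` and supported in a set of volume at most `B * r ^ q`
has `L^θ` norm at most `K * B * r ^ (a - q * (1 - 1 / θ))`. -/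
lemma eLpNorm_le_of_bound_of_support {α F : Type*} [MeasurableSpace α] [NormedAddCommGroup F]
    {μ : Measure α} {f : α → F} {T : Set α} {θ : ℝ≥0∞} (hθ : 1 ≤ θ) {K B r a q : ℝ}
    (hr : 0 < r) (hK : 0 ≤ K) (hB : 1 ≤ B) (hbound : ∀ m, ‖f m‖ ≤ K * r ^ (a - q))
    (hsupp : ∀ m, f m ≠ 0 → m ∈ T) (hT : μ T ≤ ENNReal.ofReal (B * r ^ q)) :
    eLpNorm f θ μ ≤ ENNReal.ofReal (K * B * r ^ (a - q * (1 - 1 / θ).toReal)) := by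
  have hmono : eLpNorm f θ μ ≤ eLpNorm (T.indicator fun _ => K * r ^ (a - q)) θ μ := by
    refine eLpNorm_mono fun m => ?_
    by_cases hm : m ∈ T
    · rw [Set.indicator_of_mem hm]
      exact (hbound m).trans (le_abs_self _)
    · have : f m = 0 := by
        by_contra hne
        exact hm (hsupp m hne)
      simp [this]
  have hθ' : (1 - 1 / θ).toReal = 1 - 1 / θ.toReal := by
    rw [ENNReal.toReal_sub_of_le (by simpa using hθ) (by simp)]
    simp
  set p := 1 / θ.toReal with hp
  have hp0 : 0 ≤ p := by positivity
  have hp1 : p ≤ 1 := by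
    have := ENNReal.toReal_nonneg (a := 1 - 1 / θ)
    linarith
  calc eLpNorm f θ μ ≤ _ := hmono
    _ ≤ ‖K * r ^ (a - q)‖ₑ * μ T ^ p := eLpNorm_indicator_const_le _ _
    _ ≤ ENNReal.ofReal (K * r ^ (a - q)) * ENNReal.ofReal (B * r ^ q) ^ p := by
        rw [Real.enorm_of_nonneg (by positivity)]
        gcongr
    _ = ENNReal.ofReal (K * r ^ (a - q) * (B * r ^ q) ^ p) := by
        rw [ENNReal.ofReal_rpow_of_nonneg (by positivity) hp0, ← ENNReal.ofReal_mul (by positivity)]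
    _ ≤ _ := by
        apply ENNReal.ofReal_le_ofReal
        rw [Real.mul_rpow (by positivity) (by positivity), ← Real.rpow_mul hr.le, hθ']
        have hBp : B ^ p ≤ B := by
          simpa using Real.rpow_le_rpow_of_exponent_le hB hp1
        have hexp : r ^ (a - q * (1 - p)) = r ^ (a - q) * r ^ (q * p) := by
          rw [← Real.rpow_add hr]
          ring_nf
        rw [hexp]
        calc K * r ^ (a - q) * (B ^ p * r ^ (q * p))
            ≤ K * r ^ (a - q) * (B * r ^ (q * p)) := by gcongr
          _ = _ := by ring

lemma Am_eq {m0 : ℝ} (hm : m0 ≠ 0) (r : ℝ) :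
    Am m0 r = !![g1 r, m0 * g2 r; h1 r / m0, h2 r] := by
  have hD : (Dm m0)⁻¹ = !![m0⁻¹, 0; 0, 1] := by
    apply Matrix.inv_eq_left_inv
    ext i j
    fin_cases i <;> fin_cases j <;> simp [Dm, Matrix.mul_apply, hm]
  rw [Am, hD]
  ext i j
  fin_cases i <;> fin_cases j <;> simp [Dm, Wm, Matrix.mul_apply, div_eq_mul_inv]
  field_simp

lemma g1_mul_h2_sub (r : ℝ) : g1 r * h2 r - g2 r * h1 r = -(r ^ 4 / 2) := by
  unfold g1 g2 h1 h2
  linear_combination (-(r ^ 4 / 2)) * Real.sin_sq_add_cos_sq (Real.log r)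

lemma Am_inv {m0 r : ℝ} (hm : m0 ≠ 0) (hr : r ≠ 0) :
    (Am m0 r)⁻¹ = !![-2 / r ^ 4 * h2 r, 2 / r ^ 4 * (m0 * g2 r);
      2 / r ^ 4 * (h1 r / m0), -2 / r ^ 4 * g1 r] := by
  have hdet := g1_mul_h2_sub r
  rw [Am_eq hm]
  apply Matrix.inv_eq_left_inv
  ext i j
  fin_cases i <;> fin_cases j <;> simp [Matrix.mul_apply] <;> field_simp <;>
    linarith

lemma abs_g1_le {r : ℝ} (hr : 0 < r) : |g1 r| ≤ r ^ 3 := by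
  rw [g1, abs_mul, abs_of_pos (by positivity : 0 < r ^ 3)]
  exact mul_le_of_le_one_right (by positivity) (Real.abs_sin_le_one _)

lemma abs_g2_le {r : ℝ} (hr : 0 < r) : |g2 r| ≤ r ^ 3 := by
  rw [g2, abs_mul, abs_of_pos (by positivity : 0 < r ^ 3)]
  exact mul_le_of_le_one_right (by positivity) (Real.abs_cos_le_one _)

lemma abs_h1_le {r : ℝ} (hr : 0 < r) : |h1 r| ≤ 2 * r := by
  rw [h1, abs_mul, abs_of_pos (by positivity : 0 < r / 2)]
  have : |3 * Real.sin (Real.log r) + Real.cos (Real.log r)| ≤ 4 := by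
    rw [abs_le]
    constructor <;> linarith [Real.sin_le_one (Real.log r), Real.cos_le_one (Real.log r),
      Real.neg_one_le_sin (Real.log r), Real.neg_one_le_cos (Real.log r)]
  nlinarith

lemma abs_h2_le {r : ℝ} (hr : 0 < r) : |h2 r| ≤ 2 * r := by
  rw [h2, abs_mul, abs_of_pos (by positivity : 0 < r / 2)]
  have : |3 * Real.cos (Real.log r) - Real.sin (Real.log r)| ≤ 4 := by
    rw [abs_le]
    constructor <;> linarith [Real.sin_le_one (Real.log r), Real.cos_le_one (Real.log r),
      Real.neg_one_le_sin (Real.log r), Real.neg_one_le_cos (Real.log r)]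
  nlinarith

lemma act_mul {d : ℕ} (M N : Matrix (Fin 2) (Fin 2) ℝ) (p : V d × V d) :
    act (M * N) p = act M (act N p) := by
  simp only [act, Matrix.mul_apply, Fin.sum_univ_two]
  ext i <;> simp <;> ring

lemma act_one {d : ℕ} (p : V d × V d) : act 1 p = p := by
  simp [act]

lemma act_Am_act_inv {d : ℕ} {m0 r : ℝ} (hm : m0 ≠ 0) (hr : r ≠ 0) (p : V d × V d) :
    act (Am m0 r) (act (Am m0 r)⁻¹ p) = p := by
  have hdet : IsUnit (Am m0 r).det := by
    rw [Am_eq hm, Matrix.det_fin_two_of, isUnit_iff_ne_zero]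
    have h := g1_mul_h2_sub r
    have : g1 r * h2 r - m0 * g2 r * (h1 r / m0) = -(r ^ 4 / 2) := by
      rw [← h]
      field_simp
    rw [this]
    simp [hr]
  rw [← act_mul, Matrix.mul_nonsing_inv _ hdet, act_one]

/-- The closed set containing the support of `Ktil ψ r`, with its spatial ball centred at `c`. -/
def kinSuppBox {d : ℕ} (c : V d) (r : ℝ) : Set (Pt d) :=
  Set.Icc (-2 * r ^ 2) (-r ^ 2) ×ˢ
    (Metric.closedBall c (3 * r ^ 3) ×ˢ Metric.closedBall 0 (4 * r))

lemma isClosed_kinSuppBox {d : ℕ} (c : V d) (r : ℝ) : IsClosed (kinSuppBox c r) :=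
  isClosed_Icc.prod (Metric.isClosed_closedBall.prod Metric.isClosed_closedBall)

lemma volume_kinSuppBox {d : ℕ} (c : V d) {r : ℝ} (hr : 0 < r) :
    volume (kinSuppBox c r) =
      ENNReal.ofReal (12 ^ d * (volume (Metric.ball (0 : V d) 1)).toReal ^ 2 *
        r ^ (4 * (d : ℝ) + 2)) := by
  have hκ : volume (Metric.ball (0 : V d) 1) =
      ENNReal.ofReal (volume (Metric.ball (0 : V d) 1)).toReal :=
    (ENNReal.ofReal_toReal measure_ball_lt_top.ne).symm
  rw [kinSuppBox, Measure.volume_eq_prod, Measure.prod_prod, Measure.volume_eq_prod,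
    Measure.prod_prod, Real.volume_Icc, Measure.addHaar_closedBall _ _ (by positivity),
    Measure.addHaar_closedBall _ _ (by positivity), hκ, finrank_euclideanSpace_fin,
    ← ENNReal.ofReal_mul (by positivity), ← ENNReal.ofReal_mul (by positivity),
    ← ENNReal.ofReal_mul (by positivity), ← ENNReal.ofReal_mul (by nlinarith)]
  rw [ENNReal.toReal_ofReal (by positivity)]
  have hpow : r ^ (4 * (d : ℝ) + 2) = r ^ 2 * ((r ^ 3) ^ d * r ^ d) := by
    rw [show 4 * (d : ℝ) + 2 = ((4 * d + 2 : ℕ) : ℝ) by push_cast; ring, Real.rpow_natCast]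
    ring
  rw [hpow, mul_pow, mul_pow, show (12 : ℝ) = 3 * 4 by norm_num, mul_pow]
  congr 1
  ring

lemma mem_Ioo_of_psi_ne_zero {d : ℕ} {ψ : Pt d → ℝ} (hψ : IsKineticBump ψ) {r : ℝ} {m : Pt d}
    (h : ψ (psiArg r m) ≠ 0) : m.1 / r ^ 2 ∈ Set.Ioo (-2 : ℝ) (-1) :=
  (hψ.supp _ h).1

lemma mem_kinSuppBox_of_Ktil_ne_zero {d : ℕ} {ψ : Pt d → ℝ} (hψ : IsKineticBump ψ) {r : ℝ}
    (hr : 0 < r) {m : Pt d} (h : Ktil ψ r m ≠ 0) : m ∈ kinSuppBox 0 r := by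
  obtain ⟨hs, hy, hw⟩ := hψ.supp _ (right_ne_zero_of_mul h)
  simp only [psiArg] at hs hy hw
  set m0 := m.1 / r ^ 2 with hm0
  have hne : m0 ≠ 0 := by linarith [hs.2]
  have habs : |m0| ≤ 2 := abs_le.2 ⟨by linarith [hs.1], by linarith [hs.2]⟩
  have habs' : 1 ≤ |m0| := by
    rw [abs_of_neg (by linarith [hs.2])]
    linarith [hs.2]
  have hkey := act_Am_act_inv hne hr.ne' (m.2.1, m.2.2)
  set p := act (Am m0 r)⁻¹ (m.2.1, m.2.2) with hp
  rw [Am_eq hne] at hkey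
  simp only [act, Prod.mk.injEq, Matrix.of_apply, Matrix.cons_val', Matrix.cons_val_zero,
    Matrix.cons_val_one, Matrix.cons_val_fin_one] at hkey
  refine Set.mk_mem_prod ?_ (Set.mk_mem_prod ?_ ?_)
  · have h1 := hs.1
    have h2 := hs.2
    rw [hm0, lt_div_iff₀ (by positivity)] at h1
    rw [hm0, div_lt_iff₀ (by positivity)] at h2
    constructor <;> linarith
  · rw [mem_closedBall_zero_iff, ← hkey.1]
    refine (norm_add_le _ _).trans ?_
    rw [norm_smul, norm_smul, Real.norm_eq_abs, Real.norm_eq_abs, abs_mul]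
    have e1 : |g1 r| * ‖p.1‖ ≤ r ^ 3 * 1 := by
      gcongr
      exact abs_g1_le hr
    have e2 : |m0| * |g2 r| * ‖p.2‖ ≤ 2 * r ^ 3 * 1 := by
      gcongr
      exact abs_g2_le hr
    linarith
  · rw [mem_closedBall_zero_iff, ← hkey.2]
    refine (norm_add_le _ _).trans ?_
    rw [norm_smul, norm_smul, Real.norm_eq_abs, Real.norm_eq_abs, abs_div]
    have e0 : |h1 r| / |m0| ≤ 2 * r :=
      (div_le_self (abs_nonneg _) habs').trans (abs_h1_le hr)
    have e1 : |h1 r| / |m0| * ‖p.1‖ ≤ 2 * r * 1 := by gcongr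
    have e2 : |h2 r| * ‖p.2‖ ≤ 2 * r * 1 := by
      gcongr
      exact abs_h2_le hr
    linarith

/-- The prefactor of `Ktil` on the support of `ψ (psiArg r ·)`. -/
lemma abs_prefactor_le {d : ℕ} {r s : ℝ} (hr : 0 < r) (hs : s / r ^ 2 ∈ Set.Ioo (-2 : ℝ) (-1)) :
    |-(2 ^ (d + 1)) * s * r ^ (-(4 * (d : ℤ) + 2) - 1)| ≤
      2 ^ (d + 2) * r ^ ((1 : ℝ) - (4 * (d : ℝ) + 2)) := by
  have hexp : r ^ ((1 : ℝ) - (4 * (d : ℝ) + 2)) = r ^ 2 * r ^ (-(4 * (d : ℤ) + 2) - 1) := by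
    rw [← Real.rpow_intCast, ← Real.rpow_natCast, ← Real.rpow_add hr]
    push_cast
    ring_nf
  have hs2 : |s| ≤ 2 * r ^ 2 := by
    have h1 := hs.1
    have h2 := hs.2
    rw [lt_div_iff₀ (by positivity)] at h1
    rw [div_lt_iff₀ (by positivity)] at h2
    exact abs_le.2 ⟨by linarith, by nlinarith⟩
  have hz : 0 < r ^ (-(4 * (d : ℤ) + 2) - 1) := by positivity
  rw [hexp, abs_mul, abs_mul, abs_neg, abs_of_pos hz, abs_of_pos (by positivity : (0 : ℝ) < 2 ^ (d + 1))]
  calc (2 : ℝ) ^ (d + 1) * |s| * r ^ (-(4 * (d : ℤ) + 2) - 1)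
      ≤ 2 ^ (d + 1) * (2 * r ^ 2) * r ^ (-(4 * (d : ℤ) + 2) - 1) := by gcongr
    _ = _ := by ring

lemma abs_Ktil_le {d : ℕ} {ψ : Pt d → ℝ} (hψ : IsKineticBump ψ) {M : ℝ} (hM : ∀ m, ‖ψ m‖ ≤ M)
    {r : ℝ} (hr : 0 < r) (m : Pt d) :
    |Ktil ψ r m| ≤ 2 ^ (d + 2) * M * r ^ ((1 : ℝ) - (4 * (d : ℝ) + 2)) := by
  have hM0 : 0 ≤ M := (norm_nonneg _).trans (hM 0)
  by_cases h : ψ (psiArg r m) = 0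
  · rw [Ktil, h, mul_zero, abs_zero]
    positivity
  · rw [Ktil, abs_mul]
    calc _ ≤ 2 ^ (d + 2) * r ^ ((1 : ℝ) - (4 * (d : ℝ) + 2)) * M :=
          mul_le_mul (abs_prefactor_le hr (mem_Ioo_of_psi_ne_zero hψ h)) (hM _) (abs_nonneg _)
            (by positivity)
      _ = _ := by ring

lemma norm_psiArg_sub_le {d : ℕ} {r s : ℝ} (hr : 0 < r)
    (hs : s / r ^ 2 ∈ Set.Ioo (-2 : ℝ) (-1)) (y y' w : V d) :
    ‖psiArg r (s, y', w) - psiArg r (s, y, w)‖ ≤ 4 * r ^ (-3 : ℤ) * ‖y' - y‖ := by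
  have hne : s / r ^ 2 ≠ 0 := by linarith [hs.2]
  have habs : 1 ≤ |s / r ^ 2| := by
    rw [abs_of_neg (by linarith [hs.2])]
    linarith [hs.2]
  have hz : r ^ (-3 : ℤ) = 1 / r ^ 3 := by
    rw [zpow_neg, one_div]
    norm_cast
  have hfour : 2 / r ^ 4 * (2 * r) = 4 * r ^ (-3 : ℤ) := by
    rw [hz]
    field_simp
    norm_num
  have hsub : psiArg r (s, y', w) - psiArg r (s, y, w) =
      (0, (-2 / r ^ 4 * h2 r) • (y' - y), (2 / r ^ 4 * (h1 r / (s / r ^ 2))) • (y' - y)) := by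
    simp only [psiArg, Am_inv hne hr.ne', act, Matrix.of_apply, Matrix.cons_val',
      Matrix.cons_val_zero, Matrix.cons_val_one, Matrix.cons_val_fin_one, Prod.mk_sub_mk, smul_sub]
    refine Prod.ext (by simp) (Prod.ext ?_ ?_)
    · simp
    · simp
  have hr4 : |-2 / r ^ 4| = 2 / r ^ 4 := by
    rw [abs_div, abs_of_pos (by positivity : 0 < r ^ 4)]
    norm_num
  rw [hsub, norm_prod_le_iff, norm_prod_le_iff]
  refine ⟨?_, ?_, ?_⟩
  · rw [norm_zero]
    positivity
  · rw [norm_smul, Real.norm_eq_abs, abs_mul, hr4, ← hfour]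
    gcongr
    exact abs_h2_le hr
  · rw [norm_smul, Real.norm_eq_abs, abs_mul, abs_of_pos (by positivity : 0 < 2 / r ^ 4), abs_div,
      ← hfour]
    gcongr
    exact (div_le_self (abs_nonneg _) habs).trans (abs_h1_le hr)

lemma abs_Ktil_sub_le {d : ℕ} {ψ : Pt d → ℝ} (hψ : IsKineticBump ψ) {L : NNReal}
    (hL : LipschitzWith L ψ) {r : ℝ} (hr : 0 < r) (s : ℝ) (y y' w : V d) :
    |Ktil ψ r (s, y', w) - Ktil ψ r (s, y, w)| ≤
      2 ^ (d + 4) * L * r ^ ((1 : ℝ) - (4 * (d : ℝ) + 2)) * (‖y' - y‖ * r ^ (-3 : ℤ)) := by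
  by_cases hs : s / r ^ 2 ∈ Set.Ioo (-2 : ℝ) (-1)
  · rw [Ktil, Ktil, ← mul_sub, abs_mul]
    have h1 : |ψ (psiArg r (s, y', w)) - ψ (psiArg r (s, y, w))| ≤
        L * (4 * r ^ (-3 : ℤ) * ‖y' - y‖) :=
      (hL.norm_sub_le _ _).trans (by gcongr; exact norm_psiArg_sub_le hr hs y y' w)
    calc _ ≤ 2 ^ (d + 2) * r ^ ((1 : ℝ) - (4 * (d : ℝ) + 2)) *
            (L * (4 * r ^ (-3 : ℤ) * ‖y' - y‖)) :=
          mul_le_mul (abs_prefactor_le hr hs) h1 (abs_nonneg _) (by positivity)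
      _ = _ := by ring
  · have hz : ∀ z : V d, ψ (psiArg r (s, z, w)) = 0 := fun z => by
      by_contra h
      exact hs (mem_Ioo_of_psi_ne_zero hψ h)
    rw [Ktil, Ktil, hz, hz, mul_zero, sub_zero, abs_zero]
    positivity

lemma norm_mkV_le {d : ℕ} (f : Fin d → ℝ) {K : ℝ} (hf : ∀ i, |f i| ≤ K) :
    ‖mkV f‖ ≤ d * K := by
  have hsum : mkV f = ∑ i, f i • EuclideanSpace.single i (1 : ℝ) := by
    ext j
    simp [mkV, Finset.sum_apply, Pi.single_apply]
  rw [hsum]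
  refine (norm_sum_le _ _).trans ?_
  calc ∑ i, ‖f i • EuclideanSpace.single i (1 : ℝ)‖ ≤ ∑ _i : Fin d, K := by
        refine Finset.sum_le_sum fun i _ => ?_
        simpa [norm_smul] using hf i
    _ = d * K := by simp

lemma norm_gradYker_Ktil_le {d : ℕ} {ψ : Pt d → ℝ} (hψ : IsKineticBump ψ) {L : NNReal}
    (hL : LipschitzWith L ψ) {r : ℝ} (hr : 0 < r) (m : Pt d) :
    ‖gradYker (Ktil ψ r) m‖ ≤
      d * (2 ^ (d + 4) * L * r ^ ((-2 : ℝ) - (4 * (d : ℝ) + 2))) := by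
  have hexp : r ^ ((-2 : ℝ) - (4 * (d : ℝ) + 2)) =
      r ^ ((1 : ℝ) - (4 * (d : ℝ) + 2)) * r ^ (-3 : ℤ) := by
    rw [← Real.rpow_intCast, ← Real.rpow_add hr]
    push_cast
    ring_nf
  refine norm_mkV_le _ fun i => ?_
  have hK : 0 ≤ 2 ^ (d + 4) * (L : ℝ) * r ^ ((-2 : ℝ) - (4 * (d : ℝ) + 2)) := by positivity
  have hlip : LipschitzWith (2 ^ (d + 4) * L * r ^ ((-2 : ℝ) - (4 * (d : ℝ) + 2))).toNNReal
      (fun y : V d => Ktil ψ r (m.1, y, m.2.2)) := by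
    refine LipschitzWith.of_dist_le_mul fun y' y => ?_
    rw [Real.coe_toNNReal _ hK, Real.dist_eq, dist_eq_norm, hexp]
    exact (abs_Ktil_sub_le hψ hL hr m.1 y y' m.2.2).trans_eq (by ring)
  have hnorm := norm_fderiv_le_of_lipschitz ℝ hlip (x₀ := m.2.1)
  rw [Real.coe_toNNReal _ hK] at hnorm
  refine ((fderiv ℝ (fun y : V d => Ktil ψ r (m.1, y, m.2.2)) m.2.1).le_opNorm
    (EuclideanSpace.single i 1)).trans ?_
  simpa using hnorm

lemma mem_kinSuppBox_of_gradYker_ne_zero {d : ℕ} {ψ : Pt d → ℝ} (hψ : IsKineticBump ψ) {r : ℝ}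
    (hr : 0 < r) {m : Pt d} (h : gradYker (Ktil ψ r) m ≠ 0) : m ∈ kinSuppBox 0 r := by
  by_contra hm
  apply h
  have hopen : IsOpen {y : V d | (m.1, y, m.2.2) ∉ kinSuppBox 0 r} :=
    (isClosed_kinSuppBox 0 r).isOpen_compl.preimage (by fun_prop)
  have hev : (fun y : V d => Ktil ψ r (m.1, y, m.2.2)) =ᶠ[nhds m.2.1] fun _ => 0 := by
    filter_upwards [hopen.mem_nhds hm] with y hy
    by_contra hne
    exact hy (mem_kinSuppBox_of_Ktil_ne_zero hψ hr hne)
  have hzero : fderiv ℝ (fun y : V d => Ktil ψ r (m.1, y, m.2.2)) m.2.1 = 0 := by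
    rw [hev.fderiv_eq]
    simp
  ext i
  simp [gradYker, mkV, hzero]

lemma IsKineticBump.hasCompactSupport {d : ℕ} {ψ : Pt d → ℝ} (hψ : IsKineticBump ψ) :
    HasCompactSupport ψ := by
  refine HasCompactSupport.of_support_subset_isCompact
    (isCompact_closedBall (0 : Pt d) 2) fun m hm => ?_
  obtain ⟨hs, hy, hw⟩ := hψ.supp m hm
  rw [mem_closedBall_zero_iff, norm_prod_le_iff, norm_prod_le_iff]
  refine ⟨abs_le.2 ⟨by linarith [hs.1], by linarith [hs.2]⟩, by linarith, by linarith⟩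

/-- **Corollary 2.4: L^θ bounds for `K̃_r`.** Let `1 ≤ θ ≤ ∞` with Hölder conjugate `θ'`
(so that `1/θ' = (1 − 1/θ)`). There is `C > 0` such that for every `r > 0` and `h ∈ ℝ^d`:
`‖K̃_r‖_{L^θ} ≤ C r^{1−Q/θ'}`, `‖∇_y K̃_r‖_{L^θ} ≤ C r^{−2−Q/θ'}`, and
`‖Δ_x^h K̃_r‖_{L^θ} ≤ C r^{1−Q/θ'} min{1, |h| r⁻³}`, with `Q = 4d+2`. -/
theorem statement11 (d : ℕ) (hd : 1 ≤ d) (ψ : Pt d → ℝ) (hψ : IsKineticBump ψ)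
    (θ : ℝ≥0∞) (hθ : 1 ≤ θ) :
    ∃ C : ℝ, 0 < C ∧ ∀ r : ℝ, 0 < r → ∀ h : V d,
      eLpNorm (Ktil ψ r) θ volume ≤
        ENNReal.ofReal (C * r ^ ((1 : ℝ) - (4 * (d : ℝ) + 2) * (1 - 1 / θ).toReal)) ∧
      eLpNorm (gradYker (Ktil ψ r)) θ volume ≤
        ENNReal.ofReal (C * r ^ ((-2 : ℝ) - (4 * (d : ℝ) + 2) * (1 - 1 / θ).toReal)) ∧
      eLpNorm (fun m : Pt d => Ktil ψ r (m.1, m.2.1 + h, m.2.2) - Ktil ψ r m) θ volume ≤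
        ENNReal.ofReal (C * r ^ ((1 : ℝ) - (4 * (d : ℝ) + 2) * (1 - 1 / θ).toReal) *
          min 1 (‖h‖ * r ^ (-3 : ℤ))) := by
  obtain ⟨M, hM⟩ := hψ.hasCompactSupport.exists_bound_of_continuous hψ.smooth.continuous
  obtain ⟨L, hL⟩ := hψ.smooth.lipschitzWith_of_hasCompactSupport hψ.hasCompactSupport (by simp)
  have hM0 : 0 ≤ M := (norm_nonneg _).trans (hM 0)
  set κ : ℝ := 12 ^ d * (volume (Metric.ball (0 : V d) 1)).toReal ^ 2 with hκ
  have hκ0 : 0 ≤ κ := by positivity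
  set N : ℝ := 1 + 2 * (2 ^ (d + 2) * M) + (d + 1) * (2 ^ (d + 4) * L) with hN
  have ha : 0 ≤ 2 ^ (d + 2) * M := by positivity
  have hb : 0 ≤ 2 ^ (d + 4) * (L : ℝ) := by positivity
  have hdb : 0 ≤ d * (2 ^ (d + 4) * (L : ℝ)) := by positivity
  have hN0 : 0 < N := by positivity
  have hB : 1 ≤ 1 + 2 * κ := by linarith
  refine ⟨N * (1 + 2 * κ), by positivity, fun r hr h => ?_⟩
  have hbox : volume (kinSuppBox (0 : V d) r) ≤
      ENNReal.ofReal ((1 + 2 * κ) * r ^ (4 * (d : ℝ) + 2)) := by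
    rw [volume_kinSuppBox _ hr, ← hκ]
    gcongr
    linarith
  refine ⟨?_, ?_, ?_⟩
  · refine eLpNorm_le_of_bound_of_support hθ hr hN0.le hB (fun m => ?_)
      (fun m hm => mem_kinSuppBox_of_Ktil_ne_zero hψ hr hm) hbox
    refine (abs_Ktil_le hψ hM hr m).trans ?_
    gcongr
    linarith
  · refine eLpNorm_le_of_bound_of_support hθ hr hN0.le hB (fun m => ?_)
      (fun m hm => mem_kinSuppBox_of_gradYker_ne_zero hψ hr hm) hbox
    refine (norm_gradYker_Ktil_le hψ hL hr m).trans ?_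
    rw [← mul_assoc]
    gcongr
    linarith
  · set t : ℝ := min 1 (‖h‖ * r ^ (-3 : ℤ)) with ht
    have ht0 : 0 ≤ t := le_min zero_le_one (by positivity)
    have hvol : volume (kinSuppBox (0 : V d) r ∪ kinSuppBox (-h) r) ≤
        ENNReal.ofReal ((1 + 2 * κ) * r ^ (4 * (d : ℝ) + 2)) := by
      refine (measure_union_le _ _).trans ?_
      rw [volume_kinSuppBox _ hr, volume_kinSuppBox _ hr, ← hκ,
        ← ENNReal.ofReal_add (by positivity) (by positivity), ← add_mul, ← two_mul]
      have : 2 * κ ≤ 1 + 2 * κ := by linarith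
      gcongr
    have hmain := eLpNorm_le_of_bound_of_support (μ := volume)
      (f := fun m : Pt d => Ktil ψ r (m.1, m.2.1 + h, m.2.2) - Ktil ψ r m)
      (T := kinSuppBox (0 : V d) r ∪ kinSuppBox (-h) r) (K := N * t) (a := 1)
      hθ hr (by positivity) hB (fun m => ?_) (fun m hm => ?_) hvol
    · convert hmain using 2
      ring
    · have hR : 0 ≤ r ^ ((1 : ℝ) - (4 * (d : ℝ) + 2)) := by positivity
      rcases min_choice 1 (‖h‖ * r ^ (-3 : ℤ)) with hmin | hmin
      · rw [ht, hmin, mul_one]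
        calc ‖Ktil ψ r (m.1, m.2.1 + h, m.2.2) - Ktil ψ r m‖
            ≤ ‖Ktil ψ r (m.1, m.2.1 + h, m.2.2)‖ + ‖Ktil ψ r m‖ := norm_sub_le _ _
          _ ≤ _ := add_le_add (abs_Ktil_le hψ hM hr _) (abs_Ktil_le hψ hM hr _)
          _ = 2 * (2 ^ (d + 2) * M) * r ^ ((1 : ℝ) - (4 * (d : ℝ) + 2)) := by ring
          _ ≤ _ := by
            gcongr
            linarith
      · rw [ht, hmin]
        have hdiff := abs_Ktil_sub_le hψ hL hr m.1 m.2.1 (m.2.1 + h) m.2.2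
        rw [add_sub_cancel_left] at hdiff
        refine hdiff.trans ?_
        rw [mul_right_comm]
        gcongr
        linarith
    · by_cases h0 : Ktil ψ r m = 0
      · right
        have h1 : Ktil ψ r (m.1, m.2.1 + h, m.2.2) ≠ 0 := by
          simpa [h0] using hm
        have hmem := mem_kinSuppBox_of_Ktil_ne_zero hψ hr h1
        simpa [kinSuppBox, Set.mem_prod, dist_eq_norm] using hmem
      · exact Or.inl (mem_kinSuppBox_of_Ktil_ne_zero hψ hr h0)
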